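/- Pairing of rotational representations: Let U be a tunnelling potential which additionally satisfies conj(U(conj z)) = −U(−z) for all z ∈ ℂ, and consider the chiral model D(α) built from U. Then for every α ∈ ℂ∖{0} and every p ∈ {0,1,2}: Ker_p(α) ≠ {0} if and only if Ker_{(1−p) mod 3}(α) ≠ {0}. (This is the kernel-level form of the identity Spec_{L²_{0,p}}(RV) = Spec_{L²_{0,−p+1}}(RV) for the Birman–Schwinger operator.) -/

import Mathlib

noncomputable section

open Complex MeasureTheory

namespace TBG

/-- `ω = exp(2πi/3)`. -/
def ω : ℂ := Complex.exp (2 * Real.pi * Complex.I / 3)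

/-- The moiré lattice `Λ = ℤω + ℤ ⊂ ℂ`. -/
def Λ : Set ℂ := {z : ℂ | ∃ m n : ℤ, z = m * ω + n}

/-- The dual lattice `Λ* = (4πi/√3)·Λ`. -/
def Λdual : Set ℂ := {p : ℂ | ∃ m n : ℤ, p = 4 * Real.pi * Complex.I / Real.sqrt 3 * (m * ω + n)}

/-- The high symmetry point `K = 4π/3`. -/
def K : ℂ := 4 * Real.pi / 3

/-- `⟨z,w⟩ = Re (z · conj w)`. -/
def pair (z w : ℂ) : ℝ := (z * (starRingEnd ℂ) w).re

/-- `2 D_z̄ f = (1/i)(∂_x f + i ∂_y f)`. -/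
def Dbar (f : ℂ → ℂ) (z : ℂ) : ℂ :=
  1 / Complex.I * (fderiv ℝ f z 1 + Complex.I * fderiv ℝ f z Complex.I)

/-- A tunnelling potential: smooth, with the translational and rotational symmetries. -/
def IsTunnelling (U : ℂ → ℂ) : Prop :=
  ContDiff ℝ (⊤ : ℕ∞) U ∧
    (∀ γ ∈ Λ, ∀ z : ℂ, U (z + γ) = Complex.exp (Complex.I * (pair γ K : ℂ)) * U z) ∧
    ∀ z : ℂ, U (ω * z) = ω * U z

/-- Membership in `ker_{L²₀}(D(α)+k)` for the chiral model with tunnelling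
potentials `U₊ = Up`, `U₋ = Um`: smooth solutions of `(D(α)+k)u = 0` with the
Floquet boundary conditions. -/
def InKer (Up Um : ℂ → ℂ) (α k : ℂ) (u : ℂ → ℂ × ℂ) : Prop :=
  ContDiff ℝ (⊤ : ℕ∞) u ∧
    (∀ z : ℂ, Dbar (fun w => (u w).1) z + k * (u z).1 + α * Up z * (u z).2 = 0) ∧
    (∀ z : ℂ, Dbar (fun w => (u w).2) z + k * (u z).2 + α * Um z * (u z).1 = 0) ∧
    (∀ γ ∈ Λ, ∀ z : ℂ, (u (z + γ)).1 = Complex.exp (-Complex.I * (pair γ K : ℂ)) * (u z).1) ∧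
    (∀ γ ∈ Λ, ∀ z : ℂ, (u (z + γ)).2 = Complex.exp (Complex.I * (pair γ K : ℂ)) * (u z).2)

/-- `Ker(α,k)` as a set of functions. -/
def kerSet (Up Um : ℂ → ℂ) (α k : ℂ) : Set (ℂ → ℂ × ℂ) := {u | InKer Up Um α k u}

/-- `dim_ℂ Ker(α,k)` (the set `Ker(α,k)` is a linear subspace, so the finrank of its span
is its dimension). -/
def kerDim (Up Um : ℂ → ℂ) (α k : ℂ) : ℕ :=
  Module.finrank ℂ ↥(Submodule.span ℂ (kerSet Up Um α k))

/-- `Ker_p(α) = {u ∈ Ker(α,0) : u(ωz) = ω^(−p)·u(z)}`. -/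
def kerPSet (Up Um : ℂ → ℂ) (α : ℂ) (p : ℕ) : Set (ℂ → ℂ × ℂ) :=
  {u | u ∈ kerSet Up Um α 0 ∧ ∀ z : ℂ, u (ω * z) = (ω ^ (-(p : ℤ))) • u z}

/-- `dim_ℂ Ker_p(α)`. -/
def kerPDim (Up Um : ℂ → ℂ) (α : ℂ) (p : ℕ) : ℕ :=
  Module.finrank ℂ ↥(Submodule.span ℂ (kerPSet Up Um α p))

/-- `α` is magic: the flat band condition `Ker(α,k) ≠ {0}` for every `k`. -/
def IsMagic (Up Um : ℂ → ℂ) (α : ℂ) : Prop :=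
  ∀ k : ℂ, ∃ u ∈ kerSet Up Um α k, u ≠ 0




open Filter Topology intervalIntegral

local notation "∞" => ((⊤ : ℕ∞) : WithTop ℕ∞)

/-- The weighted ray average `z ↦ ∫₀¹ tʲ F(tz) dt`. -/
def rayAverage {E : Type} [NormedAddCommGroup E] [NormedSpace ℝ E] (j : ℕ) (F : ℂ → E) (z : ℂ) :
    E :=
  ∫ t in (0 : ℝ)..1, t ^ j • F (t • z)

lemma hasFDerivAt_rayAverage {E : Type} [NormedAddCommGroup E] [NormedSpace ℝ E]
    [CompleteSpace E] (j : ℕ) {F : ℂ → E} (hF : ContDiff ℝ 1 F) (z : ℂ) :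
    HasFDerivAt (rayAverage j F) (rayAverage (j + 1) (fderiv ℝ F) z) z := by
  have hF' : Continuous (fderiv ℝ F) := hF.continuous_fderiv (by simp)
  have hFc : Continuous F := hF.continuous
  obtain ⟨C, hC⟩ := (isCompact_closedBall (0 : ℂ) (‖z‖ + 1)).exists_bound_of_continuousOn
    hF'.continuousOn
  refine intervalIntegral.hasFDerivAt_integral_of_dominated_of_fderiv_le (𝕜 := ℝ)
    (μ := volume) (a := 0) (b := 1) (bound := fun _ ↦ C)
    (F := fun x t ↦ t ^ j • F (t • x)) (F' := fun x t ↦ t ^ (j + 1) • fderiv ℝ F (t • x))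
    (Metric.ball_mem_nhds z one_pos) (Eventually.of_forall fun x ↦ ?_) ?_ ?_ ?_ ?_ ?_
  · exact Continuous.aestronglyMeasurable (by fun_prop)
  · exact Continuous.intervalIntegrable (by fun_prop) _ _
  · exact Continuous.aestronglyMeasurable (by fun_prop)
  · refine Eventually.of_forall fun t ht x hx ↦ ?_
    rw [Set.uIoc_of_le zero_le_one] at ht
    have hx' : ‖x‖ ≤ ‖z‖ + 1 := by
      have h1 := norm_sub_norm_le x z
      rw [Metric.mem_ball, dist_eq_norm] at hx
      linarith
    have h1 : ‖fderiv ℝ F (t • x)‖ ≤ C := by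
      refine hC _ ?_
      rw [mem_closedBall_zero_iff, norm_smul, Real.norm_of_nonneg ht.1.le]
      exact (mul_le_of_le_one_left (norm_nonneg x) ht.2).trans hx'
    rw [norm_smul, Real.norm_of_nonneg (pow_nonneg ht.1.le _)]
    exact (mul_le_of_le_one_left (norm_nonneg _) (pow_le_one₀ ht.1.le ht.2)).trans h1
  · exact continuous_const.intervalIntegrable _ _
  · refine Eventually.of_forall fun t _ x _ ↦ ?_
    have h1 : HasFDerivAt (fun y : ℂ ↦ t • y) (t • ContinuousLinearMap.id ℝ ℂ) x :=
      (hasFDerivAt_id x).const_smul t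
    have h2 := (((hF.differentiable (by simp)) (t • x)).hasFDerivAt.comp x h1).const_smul (t ^ j)
    convert! h2 using 1
    ext y
    simp [pow_succ, mul_smul]

lemma contDiff_rayAverage {E : Type} [NormedAddCommGroup E] [NormedSpace ℝ E] [CompleteSpace E]
    (n : ℕ) (j : ℕ) {F : ℂ → E} (hF : ContDiff ℝ ∞ F) : ContDiff ℝ n (rayAverage j F) := by
  induction n generalizing E j with
  | zero =>
    exact contDiff_zero.2 <| continuous_iff_continuousAt.2 fun z ↦
      (hasFDerivAt_rayAverage j (hF.of_le (by exact_mod_cast le_top)) z).continuousAt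
  | succ n ih =>
    push_cast
    exact contDiff_succ_iff_hasFDerivAt.2 ⟨_, ih (j + 1) (hF.fderiv_right (by simp)),
      hasFDerivAt_rayAverage j (hF.of_le (by exact_mod_cast le_top))⟩

lemma contDiff_infty_rayAverage {E : Type} [NormedAddCommGroup E] [NormedSpace ℝ E]
    [CompleteSpace E] (j : ℕ) {F : ℂ → E} (hF : ContDiff ℝ ∞ F) :
    ContDiff ℝ ∞ (rayAverage j F) :=
  contDiff_infty.2 fun n ↦ contDiff_rayAverage n j hF

lemma apply_eq_mul_add_conj_mul (L : ℂ →L[ℝ] ℂ) (z : ℂ) :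
    L z = z * ((L 1 - I * L I) / 2) + (starRingEnd ℂ) z * ((L 1 + I * L I) / 2) := by
  have h1 : z = z.re + z.im * I := (re_add_im z).symm
  have h : L z = z.re * L 1 + z.im * L I := by
    have h' : z.re • (1 : ℂ) + z.im • I = z := by simp [re_add_im]
    rw [← real_smul, ← real_smul, ← map_smul, ← map_smul, ← map_add, h']
  have h2 : (starRingEnd ℂ) z = z.re - z.im * I := by
    apply Complex.ext <;> simp
  rw [h, h2]
  linear_combination (-(L 1 - I * L I) / 2) * h1 + (z.im : ℂ) * L I * I_sq

/-- Hadamard's lemma in the coordinates `z`, `conj z`. -/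
lemma eq_mul_rayAverage_add {f : ℂ → ℂ} (hf : ContDiff ℝ ∞ f) (h0 : f 0 = 0) (z : ℂ) :
    f z = z * rayAverage 0 (fun w ↦ (fderiv ℝ f w 1 - I * fderiv ℝ f w I) / 2) z +
      (starRingEnd ℂ) z * rayAverage 0 (fun w ↦ I / 2 * Dbar f w) z := by
  have hf' : Continuous (fderiv ℝ f) := hf.continuous_fderiv (by simp)
  have hd : ∀ t ∈ Set.uIcc (0 : ℝ) 1,
      HasDerivAt (fun t : ℝ ↦ f (t • z)) (fderiv ℝ f (t • z) z) t := fun t _ ↦ by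
    have h1 : HasDerivAt (fun t : ℝ ↦ t • z) z t := by
      simpa using (hasDerivAt_id t).smul_const z
    exact ((hf.differentiable (by simp)) (t • z)).hasFDerivAt.comp_hasDerivAt t h1
  have key := integral_eq_sub_of_hasDerivAt hd
    (Continuous.intervalIntegrable (by fun_prop) _ _)
  simp only [one_smul, zero_smul, h0, sub_zero] at key
  rw [← key, rayAverage, rayAverage, ← intervalIntegral.integral_const_mul,
    ← intervalIntegral.integral_const_mul, ← intervalIntegral.integral_add]
  · refine intervalIntegral.integral_congr fun t _ ↦ ?_
    simp only [pow_zero, one_smul, Dbar]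
    conv_lhs => rw [apply_eq_mul_add_conj_mul]
    congr 2
    field_simp
  · exact Continuous.intervalIntegrable (by fun_prop) _ _
  · refine Continuous.intervalIntegrable ?_ _ _
    simp only [Dbar]
    fun_prop

lemma exists_eq_mul_add_conj_pow_succ {f h A a d : ℂ → ℂ} {n : ℕ} (hf : ContDiff ℝ ∞ f)
    (h0 : f 0 = 0) (hA : ContDiff ℝ ∞ A) (ha : ContDiff ℝ ∞ a) (hd : ContDiff ℝ ∞ d)
    (hfh : ∀ z, Dbar f z + A z * h z = 0)
    (hh : ∀ z, h z = z * a z + (starRingEnd ℂ) z ^ n * d z) :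
    ∃ a' d' : ℂ → ℂ, ContDiff ℝ ∞ a' ∧ ContDiff ℝ ∞ d' ∧
      ∀ z, f z = z * a' z + (starRingEnd ℂ) z ^ (n + 1) * d' z := by
  have hf' : ContDiff ℝ ∞ (fderiv ℝ f) := hf.fderiv_right (by simp)
  have hconj : ContDiff ℝ ∞ (fun z : ℂ ↦ (starRingEnd ℂ) z) := conjCLE.contDiff
  have hF1 : ContDiff ℝ ∞ (fun w ↦ (fderiv ℝ f w 1 - I * fderiv ℝ f w I) / 2) := by fun_prop
  have hF2 : ContDiff ℝ ∞ (fun w ↦ -(I / 2) * A w * a w) := by fun_prop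
  have hF3 : ContDiff ℝ ∞ (fun w ↦ -(I / 2) * A w * d w) := by fun_prop
  have c1 := contDiff_infty_rayAverage 0 hF1
  have c2 := contDiff_infty_rayAverage 1 hF2
  have c3 := contDiff_infty_rayAverage n hF3
  refine ⟨fun z ↦ rayAverage 0 (fun w ↦ (fderiv ℝ f w 1 - I * fderiv ℝ f w I) / 2) z +
    (starRingEnd ℂ) z * rayAverage 1 (fun w ↦ -(I / 2) * A w * a w) z,
    rayAverage n (fun w ↦ -(I / 2) * A w * d w), by fun_prop, c3, fun z ↦ ?_⟩
  have key : rayAverage 0 (fun w ↦ I / 2 * Dbar f w) z =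
      z * rayAverage 1 (fun w ↦ -(I / 2) * A w * a w) z +
        (starRingEnd ℂ) z ^ n * rayAverage n (fun w ↦ -(I / 2) * A w * d w) z := by
    have hAc := hA.continuous
    have hac := ha.continuous
    have hdc := hd.continuous
    rw [rayAverage, rayAverage, rayAverage, ← intervalIntegral.integral_const_mul,
      ← intervalIntegral.integral_const_mul, ← intervalIntegral.integral_add]
    · refine intervalIntegral.integral_congr fun t _ ↦ ?_
      simp only [eq_neg_of_add_eq_zero_left (hfh _), hh, real_smul, map_mul, conj_ofReal]
      push_cast
      ring
    · exact Continuous.intervalIntegrable (by fun_prop) _ _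
    · exact Continuous.intervalIntegrable (by fun_prop) _ _
  rw [eq_mul_rayAverage_add hf h0 z, key]
  ring

lemma norm_conj_pow_mul_inv_pow {n m : ℕ} (h : m < n) (z : ℂ) :
    ‖(starRingEnd ℂ) z ^ n * z⁻¹ ^ m‖ = ‖z‖ ^ (n - m) := by
  rw [norm_mul, norm_pow, norm_pow, norm_inv, RCLike.norm_conj]
  rcases eq_or_ne z 0 with rfl | hz
  · simp [show n ≠ 0 by omega, show n - m ≠ 0 by omega]
  · rw [pow_sub₀ _ (norm_ne_zero_iff.2 hz) h.le, inv_pow]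

lemma hasFDerivAt_conj_pow_mul_inv_pow {n m : ℕ} (h : m + 1 ≤ n) (z : ℂ) :
    HasFDerivAt (𝕜 := ℝ) (fun z : ℂ ↦ (starRingEnd ℂ) z ^ (n + 1) * z⁻¹ ^ m)
      (((n + 1 : ℂ) * ((starRingEnd ℂ) z ^ n * z⁻¹ ^ m)) • (conjCLE : ℂ →L[ℝ] ℂ) -
        ((m : ℂ) * ((starRingEnd ℂ) z ^ (n + 1) * z⁻¹ ^ (m + 1))) •
          ContinuousLinearMap.id ℝ ℂ) z := by
  rcases eq_or_ne z 0 with rfl | hz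
  · have h0 : (((n + 1 : ℂ) * ((starRingEnd ℂ) (0 : ℂ) ^ n * (0 : ℂ)⁻¹ ^ m)) •
        (conjCLE : ℂ →L[ℝ] ℂ) - ((m : ℂ) * ((starRingEnd ℂ) (0 : ℂ) ^ (n + 1) *
          (0 : ℂ)⁻¹ ^ (m + 1))) • ContinuousLinearMap.id ℝ ℂ) = 0 := by
      rw [map_zero, zero_pow (by omega : n ≠ 0), zero_pow (by omega : n + 1 ≠ 0)]
      ext y
      simp
    rw [h0]
    refine Asymptotics.IsBigO.hasFDerivAt (n := n + 1 - m) ?_ (by omega)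
    refine Asymptotics.IsBigO.of_norm_le fun w ↦ ?_
    rw [norm_conj_pow_mul_inv_pow (by omega), sub_zero]
  · have h1 : HasFDerivAt (𝕜 := ℝ) (fun z : ℂ ↦ (starRingEnd ℂ) z) (conjCLE : ℂ →L[ℝ] ℂ) z :=
      (conjCLE : ℂ →L[ℝ] ℂ).hasFDerivAt
    have h2 : HasFDerivAt (𝕜 := ℝ) (fun z : ℂ ↦ z⁻¹)
        ((-(z ^ 2)⁻¹) • ContinuousLinearMap.id ℝ ℂ) z := by
      have h3 := ((hasDerivAt_inv hz).hasFDerivAt).restrictScalars ℝ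
      convert! h3 using 1
      ext y
      simp [mul_comm]
    have h3 := (h1.pow (n + 1)).mul (h2.pow m)
    convert! h3 using 1
    ext y
    rcases m with _ | m
    · simp
    · simp
      field_simp
      ring

lemma contDiff_conj_pow_mul_inv_pow {k n m : ℕ} (h : m + k + 1 ≤ n) :
    ContDiff ℝ k (fun z : ℂ ↦ (starRingEnd ℂ) z ^ n * z⁻¹ ^ m) := by
  induction k generalizing n m with
  | zero =>
    refine contDiff_zero.2 <| continuous_iff_continuousAt.2 fun z ↦ ?_
    rcases eq_or_ne z 0 with rfl | hz
    · have h1 : Tendsto (fun z : ℂ ↦ ‖z‖ ^ (n - m)) (𝓝 0) (𝓝 0) := by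
        have : ContinuousAt (fun z : ℂ ↦ ‖z‖ ^ (n - m)) 0 := by fun_prop
        simpa [ContinuousAt, show n - m ≠ 0 by omega] using this
      have h2 : ((starRingEnd ℂ) (0 : ℂ) ^ n * (0 : ℂ)⁻¹ ^ m) = 0 := by
        simp [show n ≠ 0 by omega]
      rw [ContinuousAt, h2]
      refine squeeze_zero_norm (fun w ↦ ?_) h1
      rw [norm_conj_pow_mul_inv_pow (by omega)]
    · have := continuous_conj.continuousAt (x := z)
      fun_prop (disch := assumption)
  | succ k ih =>
    obtain ⟨n, rfl⟩ : ∃ n', n = n' + 1 := ⟨n - 1, by omega⟩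
    push_cast
    refine contDiff_succ_iff_hasFDerivAt.2 ⟨_, ?_, fun z ↦
      hasFDerivAt_conj_pow_mul_inv_pow (by omega) z⟩
    have h1 := ih (n := n) (m := m) (by omega)
    have h2 := ih (n := n + 1) (m := m + 1) (by omega)
    exact ((contDiff_const.mul h1).smul contDiff_const).sub
      ((contDiff_const.mul h2).smul contDiff_const)

/-- Smooth solutions of the first-order system `2D_z̄ u₁ + A u₂ = 0`, `2D_z̄ u₂ + B u₁ = 0`. -/
def IsSol (A B : ℂ → ℂ) (u : ℂ → ℂ × ℂ) : Prop :=
  ContDiff ℝ ∞ u ∧ (∀ z, Dbar (fun w ↦ (u w).1) z + A z * (u z).2 = 0) ∧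
    ∀ z, Dbar (fun w ↦ (u w).2) z + B z * (u z).1 = 0

lemma Dbar_mul {g f : ℂ → ℂ} {z : ℂ} (hg : DifferentiableAt ℂ g z)
    (hf : DifferentiableAt ℝ f z) : Dbar (fun w ↦ g w * f w) z = g z * Dbar f z := by
  have hg' : HasFDerivAt g ((fderiv ℂ g z).restrictScalars ℝ) z :=
    hg.hasFDerivAt.restrictScalars ℝ
  have hI : fderiv ℂ g z I = I * fderiv ℂ g z 1 := by
    simp
  have h := (hg'.mul hf.hasFDerivAt).fderiv
  rw [show (fun w ↦ g w * f w) = g * f from rfl]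
  simp only [Dbar, h]
  simp only [add_apply, smul_apply,
    ContinuousLinearMap.coe_restrictScalars', smul_eq_mul, hI]
  linear_combination (1 / I * f z * fderiv ℂ g z 1) * I_sq

lemma Dbar_congr {f g : ℂ → ℂ} {z : ℂ} (h : f =ᶠ[𝓝 z] g) : Dbar f z = Dbar g z := by
  simp only [Dbar, h.fderiv_eq]

lemma continuous_Dbar {f : ℂ → ℂ} (hf : ContDiff ℝ ∞ f) : Continuous (Dbar f) := by
  have hf' : Continuous (fderiv ℝ f) := hf.continuous_fderiv (by simp)
  unfold Dbar
  fun_prop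

lemma eq_zero_of_eventually_punctured {E : Type} [NormedAddCommGroup E] {F : ℂ → E} {z₀ : ℂ}
    (hF : ContinuousAt F z₀) (h : ∀ᶠ z in 𝓝[≠] z₀, F z = 0) : F z₀ = 0 :=
  tendsto_nhds_unique (hF.tendsto.mono_left nhdsWithin_le_nhds)
    (tendsto_const_nhds.congr' (h.mono fun _ hz ↦ hz.symm))

lemma tendsto_punctured {τ : ℂ → ℂ} {z₀ : ℂ} (hc : ContinuousAt τ z₀) (hτ : τ.Injective) :
    Tendsto τ (𝓝[≠] z₀) (𝓝[≠] (τ z₀)) :=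
  tendsto_nhdsWithin_iff.2 ⟨hc.tendsto.mono_left nhdsWithin_le_nhds,
    eventually_mem_nhdsWithin.mono fun _ hz ↦ hτ.ne hz⟩

lemma eventually_punctured_eventuallyEq {E : Type} {f g : ℂ → E} {z₀ : ℂ}
    (h : ∀ᶠ z in 𝓝[≠] z₀, f z = g z) : ∀ᶠ z in 𝓝[≠] z₀, f =ᶠ[𝓝 z] g := by
  filter_upwards [eventually_eventually_nhdsWithin.2 h, self_mem_nhdsWithin] with z hz hne
  rwa [nhdsWithin_eq_nhds.2 (isOpen_compl_singleton.mem_nhds hne)] at hz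

/-- Removal of the singularities of a function that is finitely smooth near every point, after
redefinition at that point. -/
lemma exists_contDiff_extension {E : Type} [NormedAddCommGroup E] [NormedSpace ℝ E] {f : ℂ → E}
    (h : ∀ (z₀ : ℂ) (n : ℕ), ∃ w : ℂ → E, ContDiffAt ℝ n w z₀ ∧ ∀ᶠ z in 𝓝[≠] z₀, f z = w z) :
    ∃ v : ℂ → E, ContDiff ℝ ∞ v ∧ ∀ z₀, ∀ᶠ z in 𝓝[≠] z₀, v z = f z := by
  have hlim : ∀ z₀ (w : ℂ → E), ContinuousAt w z₀ → (∀ᶠ z in 𝓝[≠] z₀, f z = w z) →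
      limUnder (𝓝[≠] z₀) f = w z₀ := fun z₀ w hw hfw ↦
    ((hw.tendsto.mono_left nhdsWithin_le_nhds).congr' (hfw.mono fun _ hz ↦ hz.symm)).limUnder_eq
  have key : ∀ z₀ (n : ℕ) (w : ℂ → E), ContDiffAt ℝ n w z₀ → (∀ᶠ z in 𝓝[≠] z₀, f z = w z) →
      ∀ᶠ z in 𝓝 z₀, limUnder (𝓝[≠] z) f = w z := by
    intro z₀ n w hw hfw
    have h1 := hw.eventually (by simp)
    have h2 : ∀ᶠ z in 𝓝 z₀, ∀ᶠ y in 𝓝[≠] z, f y = w y := by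
      filter_upwards [eventually_nhdsWithin_iff.1 (eventually_punctured_eventuallyEq hfw)]
        with z hz
      rcases eq_or_ne z z₀ with rfl | hne
      · exact hfw
      · exact (hz hne).filter_mono nhdsWithin_le_nhds
    filter_upwards [h1, h2] with z hz1 hz2
    exact hlim z w hz1.continuousAt hz2
  refine ⟨fun z ↦ limUnder (𝓝[≠] z) f, contDiff_infty.2 fun n ↦
    contDiff_iff_contDiffAt.2 fun z₀ ↦ ?_, fun z₀ ↦ ?_⟩
  · obtain ⟨w, hw, hfw⟩ := h z₀ n
    exact hw.congr_of_eventuallyEq (key z₀ n w hw hfw)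
  · obtain ⟨w, hw, hfw⟩ := h z₀ 0
    filter_upwards [(key z₀ 0 w hw hfw).filter_mono nhdsWithin_le_nhds, hfw] with z h1 h2
    rw [h1, h2]

/-- A solution multiplied by a meromorphic function, when smooth, is again a solution. -/
lemma IsSol.exists_meromorphic_smul {A B : ℂ → ℂ} {u : ℂ → ℂ × ℂ} (hA : Continuous A)
    (hB : Continuous B) (hu : IsSol A B u) {g : ℂ → ℂ} (hg : ∀ z, MeromorphicAt g z)
    (h : ∀ (z₀ : ℂ) (n : ℕ), ∃ w : ℂ → ℂ × ℂ, ContDiffAt ℝ n w z₀ ∧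
      ∀ᶠ z in 𝓝[≠] z₀, g z • u z = w z) :
    ∃ v, IsSol A B v ∧ ∀ z₀, ∀ᶠ z in 𝓝[≠] z₀, v z = g z • u z := by
  obtain ⟨v, hv, hvu⟩ := exists_contDiff_extension h
  obtain ⟨hu0, hu1, hu2⟩ := hu
  have hvc := hv.continuous
  have d1 := continuous_Dbar (contDiff_fst.comp hv)
  have d2 := continuous_Dbar (contDiff_snd.comp hv)
  refine ⟨v, ⟨hv, fun z₀ ↦ ?_, fun z₀ ↦ ?_⟩, hvu⟩
  · refine eq_zero_of_eventually_punctured (F := fun z ↦ Dbar (fun w ↦ (v w).1) z + A z * (v z).2)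
      (d1.add (by fun_prop)).continuousAt ?_
    filter_upwards [eventually_punctured_eventuallyEq (hvu z₀), (hg z₀).eventually_analyticAt]
      with z hz hgz
    have h1 : (fun w ↦ (v w).1) =ᶠ[𝓝 z] fun w ↦ g w * (u w).1 :=
      hz.mono fun w hw ↦ by simp [hw]
    have h2 : DifferentiableAt ℝ (fun w ↦ (u w).1) z :=
      (contDiff_fst.comp hu0).differentiable (by simp) z
    rw [Dbar_congr h1, Dbar_mul hgz.differentiableAt h2, hz.self_of_nhds]
    simp only [Prod.smul_snd, smul_eq_mul]
    linear_combination g z * hu1 z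
  · refine eq_zero_of_eventually_punctured (F := fun z ↦ Dbar (fun w ↦ (v w).2) z + B z * (v z).1)
      (d2.add (by fun_prop)).continuousAt ?_
    filter_upwards [eventually_punctured_eventuallyEq (hvu z₀), (hg z₀).eventually_analyticAt]
      with z hz hgz
    have h1 : (fun w ↦ (v w).2) =ᶠ[𝓝 z] fun w ↦ g w * (u w).2 :=
      hz.mono fun w hw ↦ by simp [hw]
    have h2 : DifferentiableAt ℝ (fun w ↦ (u w).2) z :=
      (contDiff_snd.comp hu0).differentiable (by simp) z
    rw [Dbar_congr h1, Dbar_mul hgz.differentiableAt h2, hz.self_of_nhds]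
    simp only [Prod.smul_fst, smul_eq_mul]
    linear_combination g z * hu2 z

lemma IsSol.exists_eq_mul_add_conj_pow {A B : ℂ → ℂ} {u : ℂ → ℂ × ℂ} (hA : ContDiff ℝ ∞ A)
    (hB : ContDiff ℝ ∞ B) (hu : IsSol A B u) (h0 : u 0 = 0) (n : ℕ) :
    (∃ a d : ℂ → ℂ, ContDiff ℝ ∞ a ∧ ContDiff ℝ ∞ d ∧
      ∀ z, (u z).1 = z * a z + (starRingEnd ℂ) z ^ n * d z) ∧
    ∃ a d : ℂ → ℂ, ContDiff ℝ ∞ a ∧ ContDiff ℝ ∞ d ∧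
      ∀ z, (u z).2 = z * a z + (starRingEnd ℂ) z ^ n * d z := by
  obtain ⟨hu0, hu1, hu2⟩ := hu
  have c1 : ContDiff ℝ ∞ fun z ↦ (u z).1 := contDiff_fst.comp hu0
  have c2 : ContDiff ℝ ∞ fun z ↦ (u z).2 := contDiff_snd.comp hu0
  induction n with
  | zero =>
    exact ⟨⟨0, _, contDiff_const, c1, by simp⟩, ⟨0, _, contDiff_const, c2, by simp⟩⟩
  | succ n ih =>
    obtain ⟨⟨a, d, ha, hd, h⟩, ⟨a', d', ha', hd', h'⟩⟩ := ih
    exact ⟨exists_eq_mul_add_conj_pow_succ c1 (by simp [h0]) hA ha' hd' hu1 h',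
      exists_eq_mul_add_conj_pow_succ c2 (by simp [h0]) hB ha hd hu2 h⟩

lemma contDiff_add_conj_pow_mul_inv {a d : ℂ → ℂ} (ha : ContDiff ℝ ∞ a) (hd : ContDiff ℝ ∞ d)
    (n : ℕ) : ContDiff ℝ n fun z ↦ a z + (starRingEnd ℂ) z ^ (n + 2) * z⁻¹ ^ 1 * d z := by
  have ha' := contDiff_infty.1 ha n
  have hd' := contDiff_infty.1 hd n
  exact ha'.add ((contDiff_conj_pow_mul_inv_pow (by omega)).mul hd')

/-- A solution vanishing at the origin is divisible by `z`. -/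
lemma IsSol.exists_eq_smul {A B : ℂ → ℂ} {u : ℂ → ℂ × ℂ} (hA : ContDiff ℝ ∞ A)
    (hB : ContDiff ℝ ∞ B) (hu : IsSol A B u) (h0 : u 0 = 0) :
    ∃ v, IsSol A B v ∧ ∀ z, u z = z • v z := by
  have hg : ∀ z : ℂ, MeromorphicAt (fun z : ℂ ↦ z⁻¹) z := fun z ↦ by fun_prop
  obtain ⟨v, hv, hvu⟩ := hu.exists_meromorphic_smul hA.continuous hB.continuous hg
    fun z₀ n ↦ by
      obtain ⟨⟨a, d, ha, hd, h⟩, ⟨a', d', ha', hd', h'⟩⟩ :=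
        hu.exists_eq_mul_add_conj_pow hA hB h0 (n + 2)
      refine ⟨_, ((contDiff_add_conj_pow_mul_inv ha hd n).prodMk
        (contDiff_add_conj_pow_mul_inv ha' hd' n)).contDiffAt, ?_⟩
      have hne : ∀ᶠ z in 𝓝[≠] z₀, z ≠ 0 := by
        rcases eq_or_ne z₀ 0 with rfl | h
        · exact self_mem_nhdsWithin
        · exact (isOpen_ne.eventually_mem h).filter_mono nhdsWithin_le_nhds
      filter_upwards [hne] with z hz
      ext
      · simp only [Prod.smul_fst, smul_eq_mul, h]
        field_simp
      · simp only [Prod.smul_snd, smul_eq_mul, h']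
        field_simp
  refine ⟨v, hv, fun z ↦ ?_⟩
  rcases eq_or_ne z 0 with rfl | hz
  · simp [h0]
  have huc := hu.1.continuous
  have hvc := hv.1.continuous
  refine sub_eq_zero.1 (eq_zero_of_eventually_punctured (F := fun z ↦ u z - z • v z)
    (by fun_prop) ?_)
  filter_upwards [hvu z, (isOpen_ne.eventually_mem hz).filter_mono nhdsWithin_le_nhds] with y hy hy0
  rw [hy, smul_smul, mul_inv_cancel₀ hy0, one_smul, sub_self]

lemma Dbar_comp_add_right (f : ℂ → ℂ) (a z : ℂ) :
    Dbar (fun w ↦ f (w + a)) z = Dbar f (z + a) := by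
  simp only [Dbar, fderiv_comp_add_right]

lemma IsSol.comp_add_right {A B : ℂ → ℂ} {u : ℂ → ℂ × ℂ} (hu : IsSol A B u) (a : ℂ) :
    IsSol (fun z ↦ A (z + a)) (fun z ↦ B (z + a)) fun z ↦ u (z + a) :=
  ⟨hu.1.comp (contDiff_id.add contDiff_const),
    fun z ↦ by simpa only [Dbar_comp_add_right (fun w ↦ (u w).1)] using hu.2.1 (z + a),
    fun z ↦ by simpa only [Dbar_comp_add_right (fun w ↦ (u w).2)] using hu.2.2 (z + a)⟩

lemma IsSol.exists_eq_sub_smul {A B : ℂ → ℂ} {u : ℂ → ℂ × ℂ} (hA : ContDiff ℝ ∞ A)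
    (hB : ContDiff ℝ ∞ B) (hu : IsSol A B u) {z₀ : ℂ} (h0 : u z₀ = 0) :
    ∃ v, IsSol A B v ∧ ∀ z, u z = (z - z₀) • v z := by
  have hc : ContDiff ℝ ∞ fun z : ℂ ↦ z + z₀ := by fun_prop
  obtain ⟨v, hv, huv⟩ := (hu.comp_add_right z₀).exists_eq_smul (hA.comp hc) (hB.comp hc)
    (by simpa using h0)
  refine ⟨fun z ↦ v (z - z₀), ?_, fun z ↦ by simpa using huv (z - z₀)⟩
  simpa [sub_eq_add_neg] using hv.comp_add_right (-z₀)

lemma isPrimitiveRoot_ω : IsPrimitiveRoot ω 3 := by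
  simpa [ω] using Complex.isPrimitiveRoot_exp 3 (by norm_num)

lemma ω_pow_three : ω ^ 3 = 1 := isPrimitiveRoot_ω.pow_eq_one

lemma ω_ne_one : ω ≠ 1 := isPrimitiveRoot_ω.ne_one (by norm_num)

lemma ω_ne_zero : ω ≠ 0 := Complex.exp_ne_zero _

lemma ω_sq_add_ω_add_one : ω ^ 2 + ω + 1 = 0 := by
  have h : (ω - 1) * (ω ^ 2 + ω + 1) = 0 := by linear_combination ω_pow_three
  exact (mul_eq_zero.1 h).resolve_left (sub_ne_zero.2 ω_ne_one)

lemma ω_re_im : ω.re = -1 / 2 ∧ ω.im ≠ 0 := by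
  have h := ω_sq_add_ω_add_one
  have h1 := congrArg Complex.re h
  have h2 := congrArg Complex.im h
  simp [pow_two] at h1 h2
  have h3 : ω.im ≠ 0 := fun h0 ↦ by
    rw [h0] at h1
    nlinarith [sq_nonneg (ω.re + 1 / 2)]
  refine ⟨?_, h3⟩
  have h4 : ω.im * (2 * ω.re + 1) = 0 := by linarith
  linarith [(mul_eq_zero.1 h4).resolve_left h3]

lemma sub_one_pow_six : (ω - 1) ^ 6 = -27 := by
  have h : (ω - 1) ^ 2 = -3 * ω := by linear_combination ω_sq_add_ω_add_one
  rw [show (ω - 1) ^ 6 = ((ω - 1) ^ 2) ^ 3 by ring, h]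
  linear_combination (-27) * ω_pow_three

lemma eq_of_pow_three_eq_one {x : ℂ} (hx : x ^ 3 = 1) : x = 1 ∨ x = ω ∨ x = ω ^ 2 := by
  have h : (x - 1) * ((x - ω) * (x - ω ^ 2)) = 0 := by
    linear_combination hx + (x * ω - x ^ 2) * ω_sq_add_ω_add_one - ω_pow_three
  rcases mul_eq_zero.1 h with h | h
  · exact Or.inl (sub_eq_zero.1 h)
  rcases mul_eq_zero.1 h with h | h
  · exact Or.inr (Or.inl (sub_eq_zero.1 h))
  · exact Or.inr (Or.inr (sub_eq_zero.1 h))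

lemma pow_three_eq_one_or {x : ℂ} (hx : x ^ 6 = 1) : x ^ 3 = 1 ∨ (-x) ^ 3 = 1 := by
  have h : (x ^ 3 - 1) * ((-x) ^ 3 - 1) = 0 := by linear_combination -hx
  simpa only [mul_eq_zero, sub_eq_zero] using h

/-- The period pair generating the lattice `Λ`. -/
def hexPair : PeriodPair where
  ω₁ := ω
  ω₂ := 1
  indep := by
    refine LinearIndependent.pair_iff.2 fun s t h ↦ ?_
    have h1 := congrArg Complex.im h
    have h2 := congrArg Complex.re h
    have hs : s = 0 := by simpa [ω_re_im.2] using h1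
    simpa [hs] using h2

lemma mem_Λ_iff {z : ℂ} : z ∈ hexPair.lattice ↔ z ∈ Λ := by
  simp only [PeriodPair.mem_lattice, hexPair, mul_one, Λ, Set.mem_ofPred_eq, eq_comm]

lemma ω_mul_mem {z : ℂ} (hz : z ∈ hexPair.lattice) : ω * z ∈ hexPair.lattice := by
  rw [mem_Λ_iff] at *
  obtain ⟨m, n, rfl⟩ := hz
  refine ⟨n - m, -m, ?_⟩
  push_cast
  linear_combination (m : ℂ) * ω_sq_add_ω_add_one

lemma one_mem : (1 : ℂ) ∈ hexPair.lattice := hexPair.ω₂_mem_lattice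

lemma ω_mem : ω ∈ hexPair.lattice := hexPair.ω₁_mem_lattice

lemma ω_sq_mem : ω ^ 2 ∈ hexPair.lattice := by
  rw [pow_two]
  exact ω_mul_mem ω_mem

lemma mem_of_pow_three_eq_one {x : ℂ} (hx : x ^ 3 = 1) : x ∈ hexPair.lattice := by
  rcases eq_of_pow_three_eq_one hx with rfl | rfl | rfl
  exacts [one_mem, ω_mem, ω_sq_mem]

/-- Rotation by `ω` as a permutation of the lattice. -/
def rotate : hexPair.lattice ≃ hexPair.lattice where
  toFun γ := ⟨ω * γ, ω_mul_mem γ.2⟩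
  invFun γ := ⟨ω * (ω * γ), ω_mul_mem (ω_mul_mem γ.2)⟩
  left_inv γ := Subtype.ext (by linear_combination (γ : ℂ) * ω_pow_three)
  right_inv γ := Subtype.ext (by linear_combination (γ : ℂ) * ω_pow_three)

/-- The lattice sum of the translates of `R`. -/
def latticeSum (R : ℂ → ℂ) (z : ℂ) : ℂ := ∑' γ : hexPair.lattice, R (z - γ)

lemma latticeSum_add (R : ℂ → ℂ) {δ : ℂ} (hδ : δ ∈ hexPair.lattice) (z : ℂ) :
    latticeSum R (z + δ) = latticeSum R z := by
  rw [latticeSum, ← (Equiv.addRight (⟨δ, hδ⟩ : hexPair.lattice)).tsum_eq]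
  simp [latticeSum]

lemma latticeSum_ω_mul {R : ℂ → ℂ} {χ : ℂ} (hR : ∀ w, R (ω * w) = χ * R w) (z : ℂ) :
    latticeSum R (ω * z) = χ * latticeSum R z := by
  rw [latticeSum, ← rotate.tsum_eq, latticeSum, ← tsum_mul_left]
  refine tsum_congr fun γ ↦ ?_
  rw [← hR, mul_sub]
  rfl

/-- `R` is holomorphic and of cubic decay outside the disc of radius two. -/
def HasCubicDecay (R : ℂ → ℂ) : Prop :=
  ∀ w : ℂ, 2 ≤ ‖w‖ → DifferentiableAt ℂ R w ∧ ‖R w‖ ≤ ‖w‖⁻¹ ^ 3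

/-- Near `w`, `R` has at most a pole of order `m`, and `(y - w)ᵐ R(y)` tends to `c` at `w`. -/
def HasPoleBound (R : ℂ → ℂ) (m : ℕ) (c : ℂ) (w : ℂ) : Prop :=
  ∃ h : ℂ → ℂ, AnalyticAt ℂ h w ∧ h w = c ∧ ∀ᶠ y in 𝓝[≠] w, (y - w) ^ m * R y = h y

lemma HasPoleBound.comp_sub {R : ℂ → ℂ} {m : ℕ} {c z γ : ℂ} (h : HasPoleBound R m c (z - γ)) :
    HasPoleBound (fun y ↦ R (y - γ)) m c z := by
  obtain ⟨h, ha, hc, he⟩ := h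
  refine ⟨fun y ↦ h (y - γ), ?_, hc, ?_⟩
  · exact AnalyticAt.fun_comp ha (by fun_prop)
  · have ht : Tendsto (fun y : ℂ ↦ y - γ) (𝓝[≠] z) (𝓝[≠] (z - γ)) :=
      tendsto_punctured (by fun_prop) (sub_left_injective)
    filter_upwards [ht.eventually he] with y hy
    rw [← hy]
    ring

lemma HasPoleBound.meromorphicAt {R : ℂ → ℂ} {m : ℕ} {c z : ℂ} (h : HasPoleBound R m c z) :
    MeromorphicAt R z := by
  obtain ⟨h, ha, -, he⟩ := h
  have h1 : MeromorphicAt (fun y ↦ ((y - z) ^ m)⁻¹ * h y) z := by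
    have := ha.meromorphicAt
    fun_prop
  refine h1.congr ?_
  filter_upwards [he, self_mem_nhdsWithin] with y hy hne
  rw [← hy, inv_mul_cancel_left₀ (pow_ne_zero _ (sub_ne_zero.2 hne))]

lemma HasPoleBound.eventually_ne_zero {R : ℂ → ℂ} {m : ℕ} {c z : ℂ} (h : HasPoleBound R m c z)
    (hc : c ≠ 0) : ∀ᶠ y in 𝓝[≠] z, R y ≠ 0 := by
  obtain ⟨h, ha, rfl, he⟩ := h
  filter_upwards [he, (ha.continuousAt.eventually_ne hc).filter_mono nhdsWithin_le_nhds]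
    with y hy hne h0
  rw [h0, mul_zero] at hy
  exact hne hy.symm

/-- Near any point a lattice sum is a finite sum plus a holomorphic function. -/
lemma exists_latticeSum_eq {R : ℂ → ℂ} (hR : HasCubicDecay R) (z₀ : ℂ) :
    ∃ (S : Finset hexPair.lattice) (T : ℂ → ℂ), (∀ γ ∉ S, 2 ≤ ‖z₀ - γ‖) ∧ AnalyticAt ℂ T z₀ ∧
      ∀ᶠ z in 𝓝 z₀, latticeSum R z = ∑ γ ∈ S, R (z - γ) + T z := by
  classical
  have hfin := (isCompact_closedBall (0 : hexPair.lattice) (2 * ‖z₀‖ + 4)).finite_of_discrete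
  obtain ⟨S, hS⟩ : ∃ S : Finset hexPair.lattice, ∀ γ ∉ S, 2 * ‖z₀‖ + 4 < ‖(γ : ℂ)‖ := by
    refine ⟨hfin.toFinset, fun γ hγ ↦ ?_⟩
    simpa using hγ
  have hlow : ∀ z ∈ Metric.ball z₀ 1, ∀ γ : {γ // γ ∉ S},
      2 ≤ ‖z - γ.1‖ ∧ ‖(γ.1 : ℂ)‖ / 2 ≤ ‖z - γ.1‖ := by
    intro z hz γ
    have h1 := hS γ.1 γ.2
    rw [Metric.mem_ball, dist_eq_norm] at hz
    have h2 := norm_sub_norm_le z z₀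
    have h3 := norm_sub_norm_le (γ.1 : ℂ) z
    rw [norm_sub_rev] at h3
    have h4 := norm_nonneg z₀
    constructor <;> linarith
  have hsum : Summable fun γ : {γ // γ ∉ S} ↦ 8 * ‖γ.1‖⁻¹ ^ 3 :=
    ((ZLattice.summable_norm_pow_inv hexPair.lattice 3 (by simp)).subtype _).mul_left 8
  have hle : ∀ (γ : {γ // γ ∉ S}) (z : ℂ), z ∈ Metric.ball z₀ 1 →
      ‖R (z - γ.1)‖ ≤ 8 * ‖γ.1‖⁻¹ ^ 3 := by
    intro γ z hz
    obtain ⟨h1, h2⟩ := hlow z hz γ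
    have h3 : 0 < ‖(γ.1 : ℂ)‖ := by linarith [hS γ.1 γ.2, norm_nonneg z₀]
    calc ‖R (z - γ.1)‖ ≤ ‖z - γ.1‖⁻¹ ^ 3 := (hR _ h1).2
      _ ≤ (‖(γ.1 : ℂ)‖ / 2)⁻¹ ^ 3 := by gcongr
      _ = 8 * ‖γ.1‖⁻¹ ^ 3 := by
        rw [inv_div, Submodule.coe_norm]
        ring
  refine ⟨S, fun z ↦ ∑' γ : {γ // γ ∉ S}, R (z - γ.1), fun γ hγ ↦
    (hlow z₀ (Metric.mem_ball_self one_pos) ⟨γ, hγ⟩).1, ?_, ?_⟩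
  · refine (differentiableOn_tsum_of_summable_norm hsum (fun γ z hz ↦ ?_) Metric.isOpen_ball
      hle).analyticAt (Metric.ball_mem_nhds z₀ one_pos)
    have h1 := (hR _ (hlow z hz γ).1).1
    exact (h1.comp (f := fun y : ℂ ↦ y - γ.1) z (by fun_prop)).differentiableWithinAt
  · filter_upwards [Metric.ball_mem_nhds z₀ one_pos] with z hz
    have hs : Summable fun γ : {γ // γ ∉ S} ↦ R (z - γ.1) :=
      .of_norm_bounded hsum fun γ ↦ hle γ z hz
    exact (Summable.sum_add_tsum_subtype_compl
      (f := fun γ : hexPair.lattice ↦ R (z - γ)) ((Finset.summable_compl_iff S).1 hs) S).symm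

lemma analyticAt_latticeSum {R : ℂ → ℂ} (hR : HasCubicDecay R) {z₀ : ℂ}
    (h : ∀ γ : hexPair.lattice, AnalyticAt ℂ R (z₀ - γ)) : AnalyticAt ℂ (latticeSum R) z₀ := by
  obtain ⟨S, T, -, hT, he⟩ := exists_latticeSum_eq hR z₀
  have h1 : AnalyticAt ℂ (fun z ↦ ∑ γ ∈ S, R (z - γ)) z₀ :=
    Finset.analyticAt_fun_sum S fun γ _ ↦
      AnalyticAt.fun_comp (h γ) (f := fun z : ℂ ↦ z - γ) (by fun_prop)
  exact (h1.fun_add hT).congr (he.mono fun _ hz ↦ hz.symm)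

lemma hasPoleBound_latticeSum {R c : ℂ → ℂ} {m : ℕ} (hm : m ≠ 0) (hR : HasCubicDecay R)
    (h : ∀ w, HasPoleBound R m (c w) w) (z₀ : ℂ) :
    ∃ S : Finset hexPair.lattice, (∀ γ ∉ S, 2 ≤ ‖z₀ - γ‖) ∧
      HasPoleBound (latticeSum R) m (∑ γ ∈ S, c (z₀ - γ)) z₀ := by
  obtain ⟨S, T, hS, hT, he⟩ := exists_latticeSum_eq hR z₀
  choose k hk hkc hke using fun γ : hexPair.lattice ↦ (h (z₀ - γ)).comp_sub
  refine ⟨S, hS, fun z ↦ ∑ γ ∈ S, k γ z + (z - z₀) ^ m * T z, ?_, ?_, ?_⟩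
  · have := Finset.analyticAt_fun_sum S fun γ _ ↦ hk γ
    fun_prop
  · simp [hkc, hm]
  · filter_upwards [he.filter_mono nhdsWithin_le_nhds,
      (Filter.eventually_all_finset S).2 fun γ _ ↦ hke γ] with z h1 h2
    rw [h1, mul_add, Finset.mul_sum, Finset.sum_congr rfl h2]

lemma meromorphicAt_latticeSum {R c : ℂ → ℂ} {m : ℕ} (hm : m ≠ 0) (hR : HasCubicDecay R)
    (h : ∀ w, HasPoleBound R m (c w) w) (z₀ : ℂ) : MeromorphicAt (latticeSum R) z₀ :=
  (hasPoleBound_latticeSum hm hR h z₀).choose_spec.2.meromorphicAt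

lemma inKer_zero_iff {Up Um : ℂ → ℂ} {α : ℂ} {u : ℂ → ℂ × ℂ} : InKer Up Um α 0 u ↔
    IsSol (fun z ↦ α * Up z) (fun z ↦ α * Um z) u ∧
    (∀ γ ∈ Λ, ∀ z : ℂ, (u (z + γ)).1 = Complex.exp (-Complex.I * (pair γ K : ℂ)) * (u z).1) ∧
    (∀ γ ∈ Λ, ∀ z : ℂ, (u (z + γ)).2 = Complex.exp (Complex.I * (pair γ K : ℂ)) * (u z).2) := by
  simp only [InKer, IsSol, zero_mul, add_zero]
  tauto

/-- Multiplication by a `Λ`-periodic meromorphic function with prescribed behaviour under rotation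
maps `Ker_p` to `Ker_q`, provided that its poles are compensated by zeros. -/
lemma exists_mem_kerPSet {U : ℂ → ℂ} (hU : ContDiff ℝ ∞ U) {α χ : ℂ} {p q : ℕ} {u : ℂ → ℂ × ℂ}
    (hu : u ∈ kerPSet U (fun z ↦ U (-z)) α p) (hu0 : u ≠ 0) {g : ℂ → ℂ} (hgm : Meromorphic g)
    (hgp : ∀ γ ∈ Λ, ∀ z, g (z + γ) = g z) (hgω : ∀ z, g (ω * z) = χ * g z)
    (hχ : χ * ω ^ (-(p : ℤ)) = ω ^ (-(q : ℤ))) {z₁ : ℂ} (hz₁ : ∀ᶠ z in 𝓝[≠] z₁, g z ≠ 0)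
    (hloc : ∀ z₀, AnalyticAt ℂ g z₀ ∨ ∃ (m : ℕ) (c : ℂ) (v : ℂ → ℂ × ℂ), ContDiff ℝ ∞ v ∧
      (∀ z, u z = (z - z₀) ^ m • v z) ∧ HasPoleBound g m c z₀) :
    ∃ v ∈ kerPSet U (fun z ↦ U (-z)) α q, v ≠ 0 := by
  obtain ⟨hker, hrot⟩ := hu
  obtain ⟨hsol, hp1, hp2⟩ := inKer_zero_iff.1 hker
  have hUc := hU.continuous
  obtain ⟨v, hv, hvu⟩ := hsol.exists_meromorphic_smul (by fun_prop) (by fun_prop) hgm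
    fun z₀ n ↦ by
      rcases hloc z₀ with h | ⟨m, c, v, hv, huv, h, ha, -, he⟩
      · have h1 : ContDiffAt ℝ n g z₀ := h.contDiffAt.restrict_scalars ℝ
        exact ⟨_, h1.smul (contDiff_infty.1 hsol.1 n).contDiffAt, Eventually.of_forall fun _ ↦ rfl⟩
      · have h1 : ContDiffAt ℝ n h z₀ := ha.contDiffAt.restrict_scalars ℝ
        refine ⟨_, h1.smul (contDiff_infty.1 hv n).contDiffAt, ?_⟩
        filter_upwards [he] with z hz
        rw [huv, Pi.smul_apply', ← hz, smul_smul, mul_comm]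
  have hvc := hv.1.continuous
  have hper : ∀ (γ z₀ : ℂ), ∀ᶠ z in 𝓝[≠] z₀, v (z + γ) = g (z + γ) • u (z + γ) := fun γ z₀ ↦
    (tendsto_punctured (τ := fun z ↦ z + γ) (by fun_prop) (add_left_injective γ)).eventually
      (hvu (z₀ + γ))
  refine ⟨v, ⟨inKer_zero_iff.2 ⟨hv, fun γ hγ z₀ ↦ ?_, fun γ hγ z₀ ↦ ?_⟩, fun z₀ ↦ ?_⟩, ?_⟩
  · refine sub_eq_zero.1 (eq_zero_of_eventually_punctured
      (F := fun z ↦ (v (z + γ)).1 - Complex.exp (-Complex.I * (pair γ K : ℂ)) * (v z).1)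
      (by fun_prop) ?_)
    filter_upwards [hvu z₀, hper γ z₀] with z h1 h2
    rw [h1, h2, hgp γ hγ, Prod.smul_fst, Prod.smul_fst, hp1 γ hγ, smul_eq_mul, smul_eq_mul]
    ring
  · refine sub_eq_zero.1 (eq_zero_of_eventually_punctured
      (F := fun z ↦ (v (z + γ)).2 - Complex.exp (Complex.I * (pair γ K : ℂ)) * (v z).2)
      (by fun_prop) ?_)
    filter_upwards [hvu z₀, hper γ z₀] with z h1 h2
    rw [h1, h2, hgp γ hγ, Prod.smul_snd, Prod.smul_snd, hp2 γ hγ, smul_eq_mul, smul_eq_mul]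
    ring
  · refine sub_eq_zero.1 (eq_zero_of_eventually_punctured
      (F := fun z ↦ v (ω * z) - ω ^ (-(q : ℤ)) • v z) (by fun_prop) ?_)
    have h3 : ∀ᶠ z in 𝓝[≠] z₀, v (ω * z) = g (ω * z) • u (ω * z) :=
      (tendsto_punctured (τ := fun z ↦ ω * z) (by fun_prop)
        (mul_right_injective₀ ω_ne_zero)).eventually (hvu (ω * z₀))
    filter_upwards [hvu z₀, h3] with z h1 h2
    rw [h1, h2, hgω, hrot, smul_smul, smul_smul, ← hχ, sub_eq_zero]
    congr 1
    ring
  · rintro rfl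
    refine hu0 (funext fun z₀ ↦ eq_zero_of_eventually_punctured
      hsol.1.continuous.continuousAt ?_)
    have h1 := hgm.exists_meromorphicOrderAt_ne_top_iff_forall.1
      ⟨z₁, (meromorphicOrderAt_ne_top_iff_eventually_ne_zero (hgm z₁)).2 hz₁⟩ z₀
    filter_upwards [hvu z₀, (meromorphicOrderAt_ne_top_iff_eventually_ne_zero (hgm z₀)).1 h1]
      with z h2 h3
    exact (smul_eq_zero.1 h2.symm).resolve_left h3

lemma exists_two_mul_re_eq {γ : ℂ} (hγ : γ ^ 6 = 1) : ∃ k : ℤ, 2 * γ.re = k ∧ ¬ 3 ∣ k := by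
  have key : ∀ x : ℂ, x ^ 3 = 1 → ∃ k : ℤ, 2 * x.re = k ∧ ¬ 3 ∣ k := by
    intro x hx
    have h1 := ω_re_im.1
    rcases eq_of_pow_three_eq_one hx with rfl | rfl | rfl
    · exact ⟨2, by simp, by decide⟩
    · exact ⟨-1, by push_cast; linarith, by decide⟩
    · refine ⟨-1, ?_, by decide⟩
      rw [show ω ^ 2 = -ω - 1 by linear_combination ω_sq_add_ω_add_one]
      simp only [sub_re, neg_re, one_re]
      push_cast
      linarith
  rcases pow_three_eq_one_or hγ with h | h
  · exact key γ h
  · obtain ⟨k, hk, hk3⟩ := key _ h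
    refine ⟨-k, ?_, by rwa [dvd_neg]⟩
    rw [neg_re] at hk
    push_cast
    linarith

lemma mem_of_pow_six_eq_one {γ : ℂ} (hγ : γ ^ 6 = 1) : γ ∈ Λ := by
  rw [← mem_Λ_iff]
  rcases pow_three_eq_one_or hγ with h | h
  · exact mem_of_pow_three_eq_one h
  · simpa using mem_of_pow_three_eq_one h

lemma pair_K (γ : ℂ) : pair γ K = γ.re * (4 * Real.pi / 3) := by
  have h : K = ((4 * Real.pi / 3 : ℝ) : ℂ) := by simp [K]
  rw [pair, h, conj_ofReal, re_mul_ofReal]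

lemma exp_pair_ne_one {γ : ℂ} (hγ : γ ^ 6 = 1) : Complex.exp (Complex.I * (pair γ K : ℂ)) ≠ 1 := by
  intro h
  obtain ⟨n, hn⟩ := Complex.exp_eq_one_iff.1 h
  obtain ⟨k, hk, hk3⟩ := exists_two_mul_re_eq hγ
  have h1 : pair γ K = n * (2 * Real.pi) := by
    have h2 : (pair γ K : ℂ) = ((n * (2 * Real.pi) : ℝ) : ℂ) := by
      refine mul_left_cancel₀ I_ne_zero ?_
      rw [hn]
      push_cast
      ring
    exact_mod_cast h2
  rw [pair_K] at h1
  have h2 : (k : ℝ) = 3 * n := by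
    rw [← hk]
    refine mul_right_cancel₀ Real.pi_ne_zero ?_
    linear_combination (3 / 2) * h1
  exact hk3 ⟨n, by exact_mod_cast h2⟩

/-- A solution invariant under rotation by `ω` vanishes at the roots of `27 z⁶ + 1`. -/
lemma apply_eq_zero_of_root {U : ℂ → ℂ} {α : ℂ} {u : ℂ → ℂ × ℂ}
    (hu : u ∈ kerPSet U (fun z ↦ U (-z)) α 0) {w : ℂ} (hw : 27 * w ^ 6 + 1 = 0) : u w = 0 := by
  obtain ⟨hker, hrot⟩ := hu
  obtain ⟨-, hp1, hp2⟩ := inKer_zero_iff.1 hker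
  have hγ : ((ω - 1) * w) ^ 6 = 1 := by
    rw [mul_pow, sub_one_pow_six]
    linear_combination -hw
  have h1 : u (w + (ω - 1) * w) = u w := by
    rw [show w + (ω - 1) * w = ω * w by ring, hrot]
    simp
  have hne := exp_pair_ne_one hγ
  have e1 := hp1 _ (mem_of_pow_six_eq_one hγ) w
  have e2 := hp2 _ (mem_of_pow_six_eq_one hγ) w
  rw [h1] at e1 e2
  ext
  · rw [neg_mul, Complex.exp_neg] at e1
    by_contra h0
    exact hne (inv_eq_one.1 (mul_eq_right₀ h0 |>.1 e1.symm))
  · by_contra h0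
    exact hne (mul_eq_right₀ h0 |>.1 e2.symm)

/-- A solution in the representation `p = 1` vanishes to second order at the lattice points. -/
lemma exists_eq_sub_pow_two_smul {U : ℂ → ℂ} (hU : ContDiff ℝ ∞ U) {α : ℂ} {u : ℂ → ℂ × ℂ}
    (hu : u ∈ kerPSet U (fun z ↦ U (-z)) α 1) {γ : ℂ} (hγ : γ ∈ Λ) :
    ∃ v : ℂ → ℂ × ℂ, ContDiff ℝ ∞ v ∧ ∀ z, u z = (z - γ) ^ 2 • v z := by
  obtain ⟨hker, hrot⟩ := hu
  obtain ⟨hsol, hp1, hp2⟩ := inKer_zero_iff.1 hker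
  have hA : ContDiff ℝ ∞ fun z ↦ α * U z := by fun_prop
  have hB : ContDiff ℝ ∞ fun z ↦ α * U (-z) := by fun_prop
  have hrot' : ∀ z, ω • u (ω * z) = u z := fun z ↦ by
    rw [hrot, smul_smul]
    simp [mul_inv_cancel₀ ω_ne_zero]
  have h0 : u 0 = 0 := by
    have h1 := hrot' 0
    rw [mul_zero] at h1
    refine (smul_eq_zero.1 (?_ : (ω - 1) • u 0 = 0)).resolve_left (sub_ne_zero.2 ω_ne_one)
    rw [sub_smul, one_smul, h1, sub_self]
  obtain ⟨v, hv, huv⟩ := hsol.exists_eq_smul hA hB h0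
  have hvc := hv.1.continuous
  have hv0 : v 0 = 0 := by
    have h1 : v (ω * 0) - ω • v 0 = 0 := by
      refine eq_zero_of_eventually_punctured (F := fun z ↦ v (ω * z) - ω • v z) (by fun_prop) ?_
      filter_upwards [self_mem_nhdsWithin] with z hz
      have h2 := hrot' z
      rw [huv, huv z, smul_smul, show ω * (ω * z) = z * ω ^ 2 by ring, mul_smul] at h2
      rw [← smul_right_injective _ hz h2, smul_smul, show ω * ω ^ 2 = 1 from
        (pow_succ' ω 2).symm.trans ω_pow_three, one_smul, sub_self]
    rw [mul_zero] at h1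
    refine (smul_eq_zero.1 (?_ : (1 - ω) • v 0 = 0)).resolve_left (sub_ne_zero.2 ω_ne_one.symm)
    rw [sub_smul, one_smul, h1]
  obtain ⟨w, hw, hvw⟩ := hv.exists_eq_smul hA hB hv0
  have huw : ∀ z, u z = z ^ 2 • w z := fun z ↦ by rw [huv, hvw, smul_smul, pow_two]
  have hw1 := contDiff_fst.comp hw.1
  have hw2 := contDiff_snd.comp hw.1
  refine ⟨fun z ↦ (Complex.exp (-Complex.I * (pair γ K : ℂ)) * (w (z - γ)).1,
    Complex.exp (Complex.I * (pair γ K : ℂ)) * (w (z - γ)).2), ?_, fun z ↦ ?_⟩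
  · have hc : ContDiff ℝ ∞ fun z : ℂ ↦ z - γ := by fun_prop
    exact (contDiff_const.mul (hw1.comp hc)).prodMk (contDiff_const.mul (hw2.comp hc))
  · have e1 := hp1 γ hγ (z - γ)
    have e2 := hp2 γ hγ (z - γ)
    rw [sub_add_cancel, huw (z - γ)] at e1 e2
    ext
    · rw [e1]
      simp only [Prod.smul_fst, smul_eq_mul]
      ring
    · rw [e2]
      simp only [Prod.smul_snd, smul_eq_mul]
      ring

/-- The kernel `w² / (27 w⁶ + 1)`. -/
def sexticKernel (w : ℂ) : ℂ := w ^ 2 / (27 * w ^ 6 + 1)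

/-- The kernel `1 / (w² (w³ - 1))`. -/
def cubicKernel (w : ℂ) : ℂ := 1 / (w ^ 2 * (w ^ 3 - 1))

lemma sexticKernel_ω_mul (w : ℂ) : sexticKernel (ω * w) = ω ^ 2 * sexticKernel w := by
  have h : (ω * w) ^ 6 = w ^ 6 := by linear_combination (w ^ 6 * (ω ^ 3 + 1)) * ω_pow_three
  rw [sexticKernel, h, sexticKernel]
  ring

lemma cubicKernel_ω_mul (w : ℂ) : cubicKernel (ω * w) = ω * cubicKernel w := by
  have h : (ω * w) ^ 3 = w ^ 3 := by linear_combination w ^ 3 * ω_pow_three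
  have h2 : (ω ^ 2)⁻¹ = ω := inv_eq_of_mul_eq_one_right (by linear_combination ω_pow_three)
  rw [cubicKernel, h, cubicKernel, mul_pow, one_div, one_div, mul_inv, mul_inv, mul_inv, h2]
  ring

lemma hasCubicDecay_sexticKernel : HasCubicDecay sexticKernel := by
  intro w hw
  have h1 : ‖w‖ ^ 5 ≤ ‖27 * w ^ 6 + 1‖ := by
    have h2 := norm_sub_norm_le (27 * w ^ 6) (-1)
    rw [sub_neg_eq_add, norm_mul, norm_pow, norm_neg, norm_one] at h2
    norm_num at h2
    have h3 : 1 ≤ ‖w‖ ^ 5 := one_le_pow₀ (by linarith)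
    nlinarith
  have h5 : 0 < ‖w‖ ^ 5 := by positivity
  have h0 : 27 * w ^ 6 + 1 ≠ 0 := norm_pos_iff.1 (h5.trans_le h1)
  refine ⟨by unfold sexticKernel; fun_prop (disch := assumption), ?_⟩
  rw [sexticKernel, norm_div, norm_pow, div_le_iff₀ (h5.trans_le h1)]
  calc ‖w‖ ^ 2 = ‖w‖⁻¹ ^ 3 * ‖w‖ ^ 5 := by field_simp
    _ ≤ _ := by gcongr

lemma hasCubicDecay_cubicKernel : HasCubicDecay cubicKernel := by
  intro w hw
  have h1 : ‖w‖ ≤ ‖w ^ 3 - 1‖ := by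
    have h2 := norm_sub_norm_le (w ^ 3) 1
    rw [norm_pow, norm_one] at h2
    nlinarith [mul_self_nonneg (‖w‖ - 2)]
  have h5 : 0 < ‖w‖ := by linarith
  have h0 : w ^ 3 - 1 ≠ 0 := norm_pos_iff.1 (h5.trans_le h1)
  have hw0 : w ≠ 0 := norm_pos_iff.1 h5
  have hm : w ^ 2 * (w ^ 3 - 1) ≠ 0 := mul_ne_zero (pow_ne_zero _ hw0) h0
  refine ⟨by unfold cubicKernel; fun_prop (disch := assumption), ?_⟩
  rw [cubicKernel, norm_div, norm_one, norm_mul, norm_pow, inv_pow, ← one_div]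
  refine one_div_le_one_div_of_le (by positivity) ?_
  rw [pow_succ]
  gcongr

lemma analyticAt_sexticKernel {w : ℂ} (hw : 27 * w ^ 6 + 1 ≠ 0) : AnalyticAt ℂ sexticKernel w := by
  unfold sexticKernel
  fun_prop (disch := assumption)

lemma analyticAt_cubicKernel {w : ℂ} (h0 : w ≠ 0) (h1 : w ^ 3 ≠ 1) :
    AnalyticAt ℂ cubicKernel w := by
  have hm : w ^ 2 * (w ^ 3 - 1) ≠ 0 := mul_ne_zero (pow_ne_zero _ h0) (sub_ne_zero.2 h1)
  unfold cubicKernel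
  fun_prop (disch := assumption)

lemma HasPoleBound.of_analyticAt {R : ℂ → ℂ} {w : ℂ} (hR : AnalyticAt ℂ R w) {m : ℕ} (hm : m ≠ 0) :
    HasPoleBound R m 0 w :=
  ⟨fun y ↦ (y - w) ^ m * R y, by fun_prop, by simp [hm], Eventually.of_forall fun _ ↦ rfl⟩

open Classical in
lemma hasPoleBound_sexticKernel (w : ℂ) : HasPoleBound sexticKernel 1
    (if 27 * w ^ 6 + 1 = 0 then w ^ 2 / (162 * w ^ 5) else 0) w := by
  split_ifs with hw
  · have hw0 : w ≠ 0 := by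
      rintro rfl
      simp at hw
    set q : ℂ → ℂ := fun y ↦
      27 * (y ^ 5 + y ^ 4 * w + y ^ 3 * w ^ 2 + y ^ 2 * w ^ 3 + y * w ^ 4 + w ^ 5) with hq
    have hqw : q w = 162 * w ^ 5 := by
      simp only [hq]
      ring
    have hqa : AnalyticAt ℂ q w := by fun_prop
    have hq0 : q w ≠ 0 := by
      rw [hqw]
      exact mul_ne_zero (by norm_num) (pow_ne_zero _ hw0)
    refine ⟨fun y ↦ y ^ 2 / q y, by fun_prop (disch := assumption), by simp only [hqw], ?_⟩
    filter_upwards [self_mem_nhdsWithin] with y hy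
    have h1 : 27 * y ^ 6 + 1 = (y - w) * q y := by
      simp only [hq]
      linear_combination hw
    rw [sexticKernel, h1, pow_one, ← mul_div_assoc, mul_div_mul_left _ _ (sub_ne_zero.2 hy)]
  · exact HasPoleBound.of_analyticAt (analyticAt_sexticKernel hw) one_ne_zero

open Classical in
lemma hasPoleBound_cubicKernel (w : ℂ) :
    HasPoleBound cubicKernel 2 (if w = 0 then -1 else 0) w := by
  split_ifs with hw
  · subst hw
    have h0 : (0 : ℂ) ^ 3 - 1 ≠ 0 := by norm_num
    refine ⟨fun y ↦ 1 / (y ^ 3 - 1), by fun_prop (disch := assumption), by norm_num, ?_⟩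
    filter_upwards [self_mem_nhdsWithin] with y hy
    rw [cubicKernel, sub_zero, ← mul_div_assoc, mul_div_mul_left _ _ (pow_ne_zero 2 hy)]
  · by_cases h1 : w ^ 3 = 1
    · have h0 : w ^ 2 * (w ^ 2 + w * w + w ^ 2) ≠ 0 := by
        rw [show w ^ 2 * (w ^ 2 + w * w + w ^ 2) = 3 * w ^ 4 by ring]
        exact mul_ne_zero (by norm_num) (pow_ne_zero _ hw)
      refine ⟨fun y ↦ (y - w) / (y ^ 2 * (y ^ 2 + y * w + w ^ 2)),
        by fun_prop (disch := assumption), by simp, ?_⟩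
      filter_upwards [self_mem_nhdsWithin] with y hy
      have h2 : y ^ 2 * (y ^ 3 - 1) = (y - w) * (y ^ 2 * (y ^ 2 + y * w + w ^ 2)) := by
        linear_combination y ^ 2 * h1
      rw [cubicKernel, h2, ← mul_div_assoc, pow_two, mul_assoc,
        mul_div_mul_left _ _ (sub_ne_zero.2 hy), mul_one]
    · exact HasPoleBound.of_analyticAt (analyticAt_cubicKernel hw h1) two_ne_zero

lemma eq_zero_of_mul_ω_add_eq_zero {a b : ℤ} (h : (a : ℂ) * ω + b = 0) : a = 0 ∧ b = 0 := by
  have h1 := congrArg Complex.im h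
  have ha : a = 0 := by simpa [ω_re_im.2] using h1
  refine ⟨ha, ?_⟩
  rw [ha] at h
  simpa using h

lemma sub_pow_three_eq {s γ : ℂ} (hs : (ω - 1) * s = 1) (hγ : γ ∈ Λ)
    (h : 27 * (s - γ) ^ 6 + 1 = 0) : (s - γ) ^ 3 = s ^ 3 := by
  have h6 : ((ω - 1) * (s - γ)) ^ 6 = 1 := by
    rw [mul_pow, sub_one_pow_six]
    linear_combination -h
  rcases pow_three_eq_one_or h6 with h3 | h3
  · refine mul_left_cancel₀ (pow_ne_zero 3 (sub_ne_zero.2 ω_ne_one)) ?_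
    rw [← mul_pow, ← mul_pow, hs, h3, one_pow]
  · obtain ⟨m, n, rfl⟩ := hγ
    rw [mul_sub, hs] at h3
    have e := ω_sq_add_ω_add_one
    exfalso
    rcases eq_of_pow_three_eq_one h3 with h | h | h
    · have := eq_zero_of_mul_ω_add_eq_zero (a := n - 2 * m) (b := -(m + n) - 2)
        (by push_cast; linear_combination h - m * e)
      omega
    · have := eq_zero_of_mul_ω_add_eq_zero (a := n - 2 * m - 1) (b := -(m + n) - 1)
        (by push_cast; linear_combination h - m * e)
      omega
    · have := eq_zero_of_mul_ω_add_eq_zero (a := n - 2 * m + 1) (b := -(m + n))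
        (by push_cast; linear_combination h + (1 - m) * e)
      omega

lemma exists_latticeSum_sexticKernel_ne_zero :
    ∃ z₁, ∀ᶠ z in 𝓝[≠] z₁, latticeSum sexticKernel z ≠ 0 := by
  classical
  have hω := sub_ne_zero.2 ω_ne_one
  obtain ⟨s, hs⟩ : ∃ s, (ω - 1) * s = 1 := ⟨(ω - 1)⁻¹, mul_inv_cancel₀ hω⟩
  have hs6 : 27 * s ^ 6 + 1 = 0 := by
    have h := congrArg (· ^ 6) hs
    simp only [mul_pow, sub_one_pow_six] at h
    linear_combination -h
  have hs0 : s ≠ 0 := right_ne_zero_of_mul_eq_one hs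
  obtain ⟨S, hS, hb⟩ := hasPoleBound_latticeSum one_ne_zero hasCubicDecay_sexticKernel
    hasPoleBound_sexticKernel s
  refine ⟨s, hb.eventually_ne_zero ?_⟩
  have h0 : (0 : hexPair.lattice) ∈ S := by
    by_contra h
    have h1 := hS 0 h
    rw [Submodule.coe_zero, sub_zero] at h1
    have h2 : 27 * ‖s‖ ^ 6 = 1 := by
      have h3 := congrArg norm (eq_neg_of_add_eq_zero_left hs6)
      simpa using h3
    have h3 : (2 : ℝ) ^ 6 ≤ ‖s‖ ^ 6 := by gcongr
    linarith
  have hterm : ∀ γ ∈ S, (if 27 * (s - (γ : ℂ)) ^ 6 + 1 = 0 then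
      (s - (γ : ℂ)) ^ 2 / (162 * (s - (γ : ℂ)) ^ 5) else 0) =
      if 27 * (s - (γ : ℂ)) ^ 6 + 1 = 0 then 1 / (162 * s ^ 3) else 0 := by
    intro γ _
    split_ifs with h
    · have h3 := sub_pow_three_eq hs (mem_Λ_iff.1 γ.2) h
      have hne : s - (γ : ℂ) ≠ 0 := fun h ↦ by
        rw [h] at h3
        exact pow_ne_zero 3 hs0 (by simpa using h3.symm)
      rw [← h3]
      field_simp
    · rfl
  rw [Finset.sum_congr rfl hterm, ← Finset.sum_filter, Finset.sum_const, nsmul_eq_mul]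
  refine mul_ne_zero (Nat.cast_ne_zero.2 (Finset.card_ne_zero_of_mem (a := 0) ?_))
    (one_div_ne_zero (mul_ne_zero (by norm_num) (pow_ne_zero _ hs0)))
  simpa [h0] using hs6

lemma latticeSum_cubicKernel_ne_zero : ∀ᶠ z in 𝓝[≠] 0, latticeSum cubicKernel z ≠ 0 := by
  classical
  obtain ⟨S, hS, hb⟩ := hasPoleBound_latticeSum two_ne_zero hasCubicDecay_cubicKernel
    hasPoleBound_cubicKernel 0
  refine hb.eventually_ne_zero ?_
  have h0 : (0 : hexPair.lattice) ∈ S := by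
    by_contra h
    have h1 := hS 0 h
    norm_num at h1
  simp [h0]

lemma exists_kerPSet_one_of_zero {U : ℂ → ℂ} (hU : ContDiff ℝ ∞ U) {α : ℂ}
    (h : ∃ u ∈ kerPSet U (fun z ↦ U (-z)) α 0, u ≠ 0) :
    ∃ u ∈ kerPSet U (fun z ↦ U (-z)) α 1, u ≠ 0 := by
  classical
  obtain ⟨u, hu, hu0⟩ := h
  obtain ⟨z₁, hz₁⟩ := exists_latticeSum_sexticKernel_ne_zero
  refine exists_mem_kerPSet hU hu hu0 (g := latticeSum sexticKernel) (χ := ω ^ 2)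
    (meromorphicAt_latticeSum one_ne_zero hasCubicDecay_sexticKernel hasPoleBound_sexticKernel)
    (fun γ hγ ↦ latticeSum_add _ (mem_Λ_iff.2 hγ)) (latticeSum_ω_mul sexticKernel_ω_mul) ?_ hz₁
    fun z₀ ↦ ?_
  · simpa using eq_inv_of_mul_eq_one_left (a := ω ^ 2) (by linear_combination ω_pow_three)
  · by_cases hr : ∃ γ ∈ Λ, 27 * (z₀ - γ) ^ 6 + 1 = 0
    · obtain ⟨γ, hγ, hr⟩ := hr
      obtain ⟨hsol, hp1, hp2⟩ := inKer_zero_iff.1 hu.1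
      have hz : u z₀ = 0 := by
        have e1 := hp1 γ hγ (z₀ - γ)
        have e2 := hp2 γ hγ (z₀ - γ)
        rw [sub_add_cancel, apply_eq_zero_of_root hu hr] at e1 e2
        ext
        · simpa using e1
        · simpa using e2
      obtain ⟨v, hv, huv⟩ := hsol.exists_eq_sub_smul (by fun_prop) (by fun_prop) hz
      obtain ⟨S, -, hb⟩ := hasPoleBound_latticeSum one_ne_zero hasCubicDecay_sexticKernel
        hasPoleBound_sexticKernel z₀
      exact Or.inr ⟨1, _, v, hv.1, fun z ↦ by rw [pow_one, huv], hb⟩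
    · exact Or.inl <| analyticAt_latticeSum hasCubicDecay_sexticKernel fun γ ↦
        analyticAt_sexticKernel fun h ↦ hr ⟨γ, mem_Λ_iff.1 γ.2, h⟩

lemma exists_kerPSet_zero_of_one {U : ℂ → ℂ} (hU : ContDiff ℝ ∞ U) {α : ℂ}
    (h : ∃ u ∈ kerPSet U (fun z ↦ U (-z)) α 1, u ≠ 0) :
    ∃ u ∈ kerPSet U (fun z ↦ U (-z)) α 0, u ≠ 0 := by
  classical
  obtain ⟨u, hu, hu0⟩ := h
  refine exists_mem_kerPSet hU hu hu0 (g := latticeSum cubicKernel) (χ := ω)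
    (meromorphicAt_latticeSum two_ne_zero hasCubicDecay_cubicKernel hasPoleBound_cubicKernel)
    (fun γ hγ ↦ latticeSum_add _ (mem_Λ_iff.2 hγ)) (latticeSum_ω_mul cubicKernel_ω_mul) ?_
    latticeSum_cubicKernel_ne_zero fun z₀ ↦ ?_
  · simp [mul_inv_cancel₀ ω_ne_zero]
  · by_cases hz : z₀ ∈ Λ
    · obtain ⟨v, hv, huv⟩ := exists_eq_sub_pow_two_smul hU hu hz
      obtain ⟨S, -, hb⟩ := hasPoleBound_latticeSum two_ne_zero hasCubicDecay_cubicKernel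
        hasPoleBound_cubicKernel z₀
      exact Or.inr ⟨2, _, v, hv, huv, hb⟩
    · have hz' : ∀ γ : hexPair.lattice, z₀ - γ ∉ hexPair.lattice := fun γ h ↦
        hz (mem_Λ_iff.1 (by simpa using add_mem h γ.2))
      exact Or.inl <| analyticAt_latticeSum hasCubicDecay_cubicKernel fun γ ↦
        analyticAt_cubicKernel (fun h ↦ hz' γ (h ▸ zero_mem _))
          fun h ↦ hz' γ (mem_of_pow_three_eq_one h)

/-- **pairing of rotational representations.**
For a tunnelling potential with `conj (U (conj z)) = −U(−z)`, for `α ≠ 0` and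
`p ∈ {0,1,2}`: `Ker_p(α) ≠ {0}` iff `Ker_{(1−p) mod 3}(α) ≠ {0}`. -/
theorem pairing_of_representations (U : ℂ → ℂ) (hU : IsTunnelling U)
    (hsym : ∀ z : ℂ, (starRingEnd ℂ) (U ((starRingEnd ℂ) z)) = -U (-z))
    (α : ℂ) (hα : α ≠ 0) (p : ℕ) (hp : p < 3) :
    (∃ u ∈ kerPSet U (fun z => U (-z)) α p, u ≠ 0) ↔
      (∃ u ∈ kerPSet U (fun z => U (-z)) α ((1 - (p : ℤ)) % 3).toNat, u ≠ 0) := by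
  interval_cases p
  · exact ⟨exists_kerPSet_one_of_zero hU.1, exists_kerPSet_zero_of_one hU.1⟩
  · exact ⟨exists_kerPSet_zero_of_one hU.1, exists_kerPSet_one_of_zero hU.1⟩
  · exact Iff.rfl

end TBG
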